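/- arXiv:2304.07474 — 6 statements merged into one kernel-verified Lean document; each statement's English description precedes it below -/
import Mathlib

section
/- For every prime p and every integer α ≥ 1, the set of integer solutions (x,y) ∈ ℤ×ℤ of y² = x² − 4p^α x with x ≥ 4p^α and y ≥ 0 has exactly α + 1 elements. -/
/-- A nonnegative solution of `y² = x² − 4Nx` beyond `4N` comes from a factorisation
`a * (a + y) = N²` with `0 < a ≤ N`. -/
theorem exists_factorisation_of_sq_eq {N x y : ℤ} (hN : 0 < N) (h : y ^ 2 = x ^ 2 - 4 * N * x)
    (hx : 4 * N ≤ x) (hy : 0 ≤ y) :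
    ∃ a : ℤ, 0 < a ∧ a ≤ N ∧ a * (a + y) = N ^ 2 ∧ x = 2 * N + 2 * a + y := by
  have hpar : Even (x - y) := by
    have hsq : Even (x ^ 2 - y ^ 2) := ⟨2 * N * x, by rw [h]; ring⟩
    rw [Int.even_sub] at hsq ⊢
    simpa [Int.even_pow] using hsq
  obtain ⟨c, hc⟩ := hpar
  obtain ⟨a, rfl⟩ : ∃ a, c = N + a := ⟨c - N, by ring⟩
  obtain rfl : x = 2 * N + 2 * a + y := by linarith
  have hprod : a * (a + y) = N ^ 2 := by linarith
  have hpos : 0 < a := by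
    by_contra! ha
    nlinarith [pow_pos hN 2]
  refine ⟨a, hpos, ?_, hprod, rfl⟩
  by_contra! ha
  nlinarith

/-- For every prime `p` and integer `α ≥ 1`, the set of integer solutions of
`y² = x² − 4p^α x` with `x ≥ 4p^α` and `y ≥ 0` has exactly `α + 1` elements. -/
theorem stmt_3 (p : ℕ) (hp : p.Prime) (α : ℕ) (hα : 1 ≤ α) :
    {xy : ℤ × ℤ | xy.2 ^ 2 = xy.1 ^ 2 - 4 * (p : ℤ) ^ α * xy.1 ∧
      4 * (p : ℤ) ^ α ≤ xy.1 ∧ 0 ≤ xy.2}.ncard = α + 1 := by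
  have hp1 : (1 : ℤ) < p := by exact_mod_cast hp.one_lt
  have hp0 : (0 : ℤ) < p := by linarith
  let f : ℕ → ℤ × ℤ := fun i =>
    (2 * (p : ℤ) ^ α + p ^ i + p ^ α * p ^ (α - i), (p : ℤ) ^ α * p ^ (α - i) - p ^ i)
  have hf : Function.Injective f := by
    intro i j hij
    have h1 := congrArg Prod.fst hij
    have h2 := congrArg Prod.snd hij
    simp only [f] at h1 h2
    exact pow_right_injective₀ hp0 hp1.ne' (by linarith : (p : ℤ) ^ i = p ^ j)
  have hset : {xy : ℤ × ℤ | xy.2 ^ 2 = xy.1 ^ 2 - 4 * (p : ℤ) ^ α * xy.1 ∧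
      4 * (p : ℤ) ^ α ≤ xy.1 ∧ 0 ≤ xy.2} = f '' (Finset.range (α + 1) : Set ℕ) := by
    ext ⟨x, y⟩
    simp only [Set.mem_ofPred_eq, Set.mem_image, Finset.mem_coe, Finset.mem_range, f,
      Prod.mk.injEq]
    constructor
    · rintro ⟨h, hx, hy⟩
      obtain ⟨a, ha, haN, hprod, rfl⟩ := exists_factorisation_of_sq_eq (pow_pos hp0 α) h hx hy
      lift a to ℕ using ha.le
      have hdvd : a ∣ p ^ (α * 2) := by
        rw [pow_mul]
        exact_mod_cast Dvd.intro _ hprod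
      obtain ⟨i, -, rfl⟩ := (Nat.dvd_prime_pow hp).1 hdvd
      have hi : i ≤ α := (Nat.pow_le_pow_iff_right hp.one_lt).1 (by exact_mod_cast haN)
      have hsplit : (p : ℤ) ^ i * p ^ (α - i) = p ^ α := by
        rw [← pow_add, Nat.add_sub_cancel' hi]
      push_cast at ha hprod ⊢
      have hcof : (p : ℤ) ^ i + y = p ^ α * p ^ (α - i) := by
        apply mul_left_cancel₀ ha.ne'
        linear_combination hprod - (p : ℤ) ^ α * hsplit
      exact ⟨i, by lia, by linarith, by linarith⟩
    · rintro ⟨i, hi, rfl, rfl⟩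
      have hi : i ≤ α := by lia
      have hsplit : (p : ℤ) ^ i * p ^ (α - i) = p ^ α := by
        rw [← pow_add, Nat.add_sub_cancel' hi]
      have hle : (p : ℤ) ^ i ≤ p ^ α := pow_le_pow_right₀ hp1.le hi
      have hone : (1 : ℤ) ≤ p ^ (α - i) := one_le_pow₀ hp1.le
      have ha : (0 : ℤ) < p ^ i := pow_pos hp0 i
      generalize (p : ℤ) ^ i = a at *
      generalize (p : ℤ) ^ (α - i) = d at *
      rw [← hsplit] at hle ⊢
      refine ⟨by ring, ?_, ?_⟩
      · nlinarith [mul_nonneg ha.le (sq_nonneg (d - 1))]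
      · nlinarith [mul_nonneg ha.le (sub_nonneg.2 hone)]
  rw [hset, Set.ncard_image_of_injective _ hf, Set.ncard_coe_finset, Finset.card_range]
end

section
/- Let p and q be distinct odd primes and n = p·q. Then the Hyper-X X = q(p+1)² + p(q+1)² and the Hyper-Y Y = pq(p+1)²(q+1)² satisfy R_n(X, Y) = 0, where R_n(X,Y) = 16n⁴X⁴ − 128n⁵X³ + (320n⁶ − 32n⁸ − 32n⁴)X² + (128n⁹ − 256n⁷ + 128n⁵)X − (16n⁶ + 16n² − 32n⁴)Y² − 64n⁴X²Y + (384n⁵ + 64n⁷ + 64n³)XY − (192n⁸ + 640n⁶ + 192n⁴)Y + 16n¹² − 64n¹⁰ + 96n⁸ − 64n⁶ + 16n⁴. -/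
/-- For `n = p·q` with `p, q` distinct odd primes, the Hyper-X and Hyper-Y satisfy
the quartic relation `R_n(X, Y) = 0`. -/
theorem stmt_7 (p q : ℤ) (hp : Prime p) (hq : Prime q) (hpodd : Odd p) (hqodd : Odd q)
    (hpq : p ≠ q) (n : ℤ) (hn : n = p * q)
    (X Y : ℤ) (hX : X = q * (p + 1) ^ 2 + p * (q + 1) ^ 2)
    (hY : Y = p * q * (p + 1) ^ 2 * (q + 1) ^ 2) :
    16 * n ^ 4 * X ^ 4 - 128 * n ^ 5 * X ^ 3
      + (320 * n ^ 6 - 32 * n ^ 8 - 32 * n ^ 4) * X ^ 2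
      + (128 * n ^ 9 - 256 * n ^ 7 + 128 * n ^ 5) * X
      - (16 * n ^ 6 + 16 * n ^ 2 - 32 * n ^ 4) * Y ^ 2
      - 64 * n ^ 4 * X ^ 2 * Y
      + (384 * n ^ 5 + 64 * n ^ 7 + 64 * n ^ 3) * X * Y
      - (192 * n ^ 8 + 640 * n ^ 6 + 192 * n ^ 4) * Y
      + 16 * n ^ 12 - 64 * n ^ 10 + 96 * n ^ 8 - 64 * n ^ 6 + 16 * n ^ 4 = 0 := by
  subst hn hX hY
  ring
end

section
/- Let n be a rational number with n ∉ {0, 1, −1}, and let X, Y be rational numbers. Define Z = ((n²−1)²/(n(n²+1)))·(Y + (64n⁴X² − (384n⁵ + 64n⁷ + 64n³)X + (192n⁸ + 640n⁶ + 192n⁴))/(32(n³−n)²)). Then R_n(X,Y) = 0 if and only if Z² = X⁴ − 16nX³ + (2n⁴ + 92n² + 2)X² − (16n⁵ + 224n³ + 16n)X + (n⁸ + 28n⁶ + 198n⁴ + 28n² + 1). -/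
/-- For rational `n ∉ {0, 1, −1}` and rationals `X, Y`, with
`Z = ((n²−1)²/(n(n²+1)))·(Y + (64n⁴X² − (384n⁵+64n⁷+64n³)X + (192n⁸+640n⁶+192n⁴))/(32(n³−n)²))`,
one has `R_n(X,Y) = 0` iff `Z² = X⁴ − 16nX³ + (2n⁴+92n²+2)X² − (16n⁵+224n³+16n)X
+ (n⁸+28n⁶+198n⁴+28n²+1)`. -/
theorem stmt_13 (n X Y : ℚ) (h0 : n ≠ 0) (h1 : n ≠ 1) (h2 : n ≠ -1)
    (Z : ℚ)
    (hZ : Z = (n ^ 2 - 1) ^ 2 / (n * (n ^ 2 + 1)) *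
      (Y + (64 * n ^ 4 * X ^ 2 - (384 * n ^ 5 + 64 * n ^ 7 + 64 * n ^ 3) * X
        + (192 * n ^ 8 + 640 * n ^ 6 + 192 * n ^ 4)) / (32 * (n ^ 3 - n) ^ 2))) :
    (16 * n ^ 4 * X ^ 4 - 128 * n ^ 5 * X ^ 3
      + (320 * n ^ 6 - 32 * n ^ 8 - 32 * n ^ 4) * X ^ 2
      + (128 * n ^ 9 - 256 * n ^ 7 + 128 * n ^ 5) * X
      - (16 * n ^ 6 + 16 * n ^ 2 - 32 * n ^ 4) * Y ^ 2
      - 64 * n ^ 4 * X ^ 2 * Y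
      + (384 * n ^ 5 + 64 * n ^ 7 + 64 * n ^ 3) * X * Y
      - (192 * n ^ 8 + 640 * n ^ 6 + 192 * n ^ 4) * Y
      + 16 * n ^ 12 - 64 * n ^ 10 + 96 * n ^ 8 - 64 * n ^ 6 + 16 * n ^ 4 = 0) ↔
    Z ^ 2 = X ^ 4 - 16 * n * X ^ 3 + (2 * n ^ 4 + 92 * n ^ 2 + 2) * X ^ 2
      - (16 * n ^ 5 + 224 * n ^ 3 + 16 * n) * X
      + (n ^ 8 + 28 * n ^ 6 + 198 * n ^ 4 + 28 * n ^ 2 + 1) := by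
  have hm : n ^ 2 - 1 ≠ 0 := by
    have h : (n - 1) * (n + 1) ≠ 0 :=
      mul_ne_zero (sub_ne_zero.mpr h1) (mt eq_neg_of_add_eq_zero_left h2)
    rwa [show n ^ 2 - 1 = (n - 1) * (n + 1) by ring]
  have hp : n ^ 2 + 1 ≠ 0 := by positivity
  have hZ' : 2 * n ^ 3 * (n ^ 2 + 1) * Z =
      2 * n ^ 2 * (n ^ 2 - 1) ^ 2 * Y + 4 * n ^ 4 * X ^ 2
        - (24 * n ^ 5 + 4 * n ^ 7 + 4 * n ^ 3) * X
        + (12 * n ^ 8 + 40 * n ^ 6 + 12 * n ^ 4) := by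
    rw [hZ, show n ^ 3 - n = n * (n ^ 2 - 1) by ring]
    field_simp
    ring
  have key : 4 * n ^ 6 * (n ^ 2 + 1) ^ 2 * ((X ^ 4 - 16 * n * X ^ 3 + (2 * n ^ 4 + 92 * n ^ 2 + 2) * X ^ 2
      - (16 * n ^ 5 + 224 * n ^ 3 + 16 * n) * X
      + (n ^ 8 + 28 * n ^ 6 + 198 * n ^ 4 + 28 * n ^ 2 + 1)) - Z ^ 2) =
      n ^ 2 * (n ^ 2 - 1) ^ 2 / 4 * (16 * n ^ 4 * X ^ 4 - 128 * n ^ 5 * X ^ 3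
      + (320 * n ^ 6 - 32 * n ^ 8 - 32 * n ^ 4) * X ^ 2
      + (128 * n ^ 9 - 256 * n ^ 7 + 128 * n ^ 5) * X
      - (16 * n ^ 6 + 16 * n ^ 2 - 32 * n ^ 4) * Y ^ 2
      - 64 * n ^ 4 * X ^ 2 * Y
      + (384 * n ^ 5 + 64 * n ^ 7 + 64 * n ^ 3) * X * Y
      - (192 * n ^ 8 + 640 * n ^ 6 + 192 * n ^ 4) * Y
      + 16 * n ^ 12 - 64 * n ^ 10 + 96 * n ^ 8 - 64 * n ^ 6 + 16 * n ^ 4) := by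
    linear_combination (-(2 * n ^ 3 * (n ^ 2 + 1) * Z +
      (2 * n ^ 2 * (n ^ 2 - 1) ^ 2 * Y + 4 * n ^ 4 * X ^ 2
        - (24 * n ^ 5 + 4 * n ^ 7 + 4 * n ^ 3) * X
        + (12 * n ^ 8 + 40 * n ^ 6 + 12 * n ^ 4)))) * hZ'
  constructor
  · intro hR
    rw [hR, mul_zero] at key
    have h := (mul_eq_zero.mp key).resolve_left (by positivity)
    exact (sub_eq_zero.mp h).symm
  · intro hQ
    rw [← hQ, sub_self, mul_zero] at key
    exact (mul_eq_zero.mp key.symm).resolve_left (by positivity)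
end

section
/- For every complex number n, the polynomial k(X) = X⁴ − 16nX³ + (2n⁴ + 92n² + 2)X² − (16n⁵ + 224n³ + 16n)X + (n⁸ + 28n⁶ + 198n⁴ + 28n² + 1) has a root of multiplicity at least 2 in ℂ; equivalently, k and its derivative k′ have a common complex root, so the Jacobi quartic Z² = k(X) is singular. -/
/-- For every complex `n`, the quartic `k(X)` has a root of multiplicity at least 2,
i.e. `k` and its derivative `k′` have a common complex root; hence the Jacobi quartic
`Z² = k(X)` is singular. -/
theorem stmt_15 (n : ℂ) :
    ∃ x : ℂ,
      (fun X : ℂ => X ^ 4 - 16 * n * X ^ 3 + (2 * n ^ 4 + 92 * n ^ 2 + 2) * X ^ 2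
        - (16 * n ^ 5 + 224 * n ^ 3 + 16 * n) * X
        + (n ^ 8 + 28 * n ^ 6 + 198 * n ^ 4 + 28 * n ^ 2 + 1)) x = 0 ∧
      deriv (fun X : ℂ => X ^ 4 - 16 * n * X ^ 3 + (2 * n ^ 4 + 92 * n ^ 2 + 2) * X ^ 2
        - (16 * n ^ 5 + 224 * n ^ 3 + 16 * n) * X
        + (n ^ 8 + 28 * n ^ 6 + 198 * n ^ 4 + 28 * n ^ 2 + 1)) x = 0 := by
  have hk : (fun X : ℂ => X ^ 4 - 16 * n * X ^ 3 + (2 * n ^ 4 + 92 * n ^ 2 + 2) * X ^ 2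
        - (16 * n ^ 5 + 224 * n ^ 3 + 16 * n) * X
        + (n ^ 8 + 28 * n ^ 6 + 198 * n ^ 4 + 28 * n ^ 2 + 1))
      = fun X : ℂ => ((X - 4 * n) ^ 2 + (n ^ 2 - 1) ^ 2) ^ 2 := by
    funext X
    ring
  rw [hk]
  set x : ℂ := 4 * n + Complex.I * (n ^ 2 - 1) with hx
  have hroot : (x - 4 * n) ^ 2 + (n ^ 2 - 1) ^ 2 = 0 := by
    rw [hx]
    linear_combination (n ^ 2 - 1) ^ 2 * Complex.I_sq
  refine ⟨x, by simp [hroot], ?_⟩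
  have hdiff : DifferentiableAt ℂ (fun X : ℂ => (X - 4 * n) ^ 2 + (n ^ 2 - 1) ^ 2) x := by
    fun_prop
  have hderiv := (hdiff.hasDerivAt.fun_pow 2).deriv
  rw [hroot] at hderiv
  simpa using hderiv
end

section
/- Let F be a field of characteristic different from 2, and let a, b, c, d, e, X, Z ∈ F with e ≠ 0 and X ≠ 0. Suppose Z² = aX⁴ + bX³ + cX² + dX + e². Define x = (2e(Z + e) + dX)/X² and y = (4e²(Z + e) + 2e(dX + cX²) − d²X²/(2e))/X³. Then y² + (d/e)xy + 2eb·y = x³ + (c − d²/(4e²))x² − 4e²a·x + a(d² − 4e²c). -/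
/-- The map `J` from the Jacobi quartic `Z² = aX⁴ + bX³ + cX² + dX + e²` to the Weierstrass
curve `y² + (d/e)xy + 2eb·y = x³ + (c − d²/(4e²))x² − 4e²a·x + a(d² − 4e²c)`,
over a field of characteristic `≠ 2`. -/
theorem stmt_17 {F : Type*} [Field F] (h2 : (2 : F) ≠ 0)
    (a b c d e X Z : F) (he : e ≠ 0) (hX : X ≠ 0)
    (hJ : Z ^ 2 = a * X ^ 4 + b * X ^ 3 + c * X ^ 2 + d * X + e ^ 2)
    (x y : F)
    (hx : x = (2 * e * (Z + e) + d * X) / X ^ 2)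
    (hy : y = (4 * e ^ 2 * (Z + e) + 2 * e * (d * X + c * X ^ 2)
      - d ^ 2 * X ^ 2 / (2 * e)) / X ^ 3) :
    y ^ 2 + (d / e) * x * y + 2 * e * b * y =
      x ^ 3 + (c - d ^ 2 / (4 * e ^ 2)) * x ^ 2 - 4 * e ^ 2 * a * x
        + a * (d ^ 2 - 4 * e ^ 2 * c) := by
  have hb : b = (Z ^ 2 - a * X ^ 4 - c * X ^ 2 - d * X - e ^ 2) / X ^ 3 := by
    rw [eq_div_iff (pow_ne_zero 3 hX)]
    linear_combination -hJ
  have h4 : (4 : F) = 2 * 2 := by norm_num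
  subst hx hy hb
  rw [h4]
  field_simp
  ring
end

section
/- Let F be a field of characteristic different from 2, and let a, b, c, d, e, x, y ∈ F with e ≠ 0 and y ≠ 0. Suppose y² + (d/e)xy + 2eb·y = x³ + (c − d²/(4e²))x² − 4e²a·x + a(d² − 4e²c). Define X = (2e(x + c) − d²/(2e))/y and Z = −e + X(Xx − d)/(2e). Then Z² = aX⁴ + bX³ + cX² + dX + e². -/
/-- The inverse map `J⁻¹` from the Weierstrass curve
`y² + (d/e)xy + 2eb·y = x³ + (c − d²/(4e²))x² − 4e²a·x + a(d² − 4e²c)` back to the Jacobi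
quartic `Z² = aX⁴ + bX³ + cX² + dX + e²`, over a field of characteristic `≠ 2`. -/
theorem stmt_18 {F : Type*} [Field F] (h2 : (2 : F) ≠ 0)
    (a b c d e x y : F) (he : e ≠ 0) (hy : y ≠ 0)
    (hW : y ^ 2 + (d / e) * x * y + 2 * e * b * y =
      x ^ 3 + (c - d ^ 2 / (4 * e ^ 2)) * x ^ 2 - 4 * e ^ 2 * a * x
        + a * (d ^ 2 - 4 * e ^ 2 * c))
    (X Z : F)
    (hX : X = (2 * e * (x + c) - d ^ 2 / (2 * e)) / y)
    (hZ : Z = -e + X * (X * x - d) / (2 * e)) :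
    Z ^ 2 = a * X ^ 4 + b * X ^ 3 + c * X ^ 2 + d * X + e ^ 2 := by
  have h4 : (4 : F) ≠ 0 := by
    rw [show (4 : F) = 2 * 2 by norm_num]
    exact mul_ne_zero h2 h2
  have hXy : 2 * e * (X * y) = 4 * e ^ 2 * (x + c) - d ^ 2 := by
    rw [hX, div_mul_cancel₀ _ hy]
    field_simp
    ring
  have hW' : 4 * e ^ 2 * y ^ 2 + 4 * e * d * x * y + 8 * e ^ 3 * b * y =
      (x ^ 2 - 4 * e ^ 2 * a) * (4 * e ^ 2 * (x + c) - d ^ 2) := by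
    have hd : d / e * e = d := div_mul_cancel₀ d he
    have hd2 : d ^ 2 / (4 * e ^ 2) * (4 * e ^ 2) = d ^ 2 :=
      div_mul_cancel₀ _ (mul_ne_zero h4 (pow_ne_zero 2 he))
    linear_combination 4 * e ^ 2 * hW - 4 * e * x * y * hd - x ^ 2 * hd2
  have key : X * (x ^ 2 - 4 * e ^ 2 * a) = 2 * e * y + 2 * d * x + 4 * e ^ 2 * b := by
    refine mul_left_cancel₀ (mul_ne_zero (mul_ne_zero h2 he) hy) ?_
    linear_combination (x ^ 2 - 4 * e ^ 2 * a) * hXy - hW'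
  have hZ' : 2 * e * Z = -2 * e ^ 2 + X * (X * x - d) := by
    rw [hZ]
    field_simp
  refine mul_left_cancel₀ (mul_ne_zero h4 (pow_ne_zero 2 he)) ?_
  linear_combination (2 * e * Z - 2 * e ^ 2 + X * (X * x - d)) * hZ' + X ^ 3 * key + X ^ 2 * hXy
end
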